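/- arXiv:math/0606556 — 2 statements merged into one kernel-verified Lean document; each statement's English description precedes it below -/
import Mathlib

section
/- The affine quantization intertwines the Lie derivatives along all vector fields X^M with M ∈ g₋₁ ⊕ g₀ (i.e. M with vanishing ξ-block): for every such M, every degree-k symbol T, and every smooth f: ℝ^m → V₁, L_{X^M}(Q_Aff(T)f) = Q_Aff(L_{X^M}T)(f) + Q_Aff(T)(L_{X^M}f). Equivalently, the cocycle γ(M) = 𝓛_{X^M} ∘ Q_Aff − Q_Aff ∘ L_{X^M} vanishes for M ∈ g₋₁ ⊕ g₀. -/
open scoped BigOperators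
noncomputable section
namespace ProjQuant

/-- `ℝ^m`. -/
abbrev Rm (m : ℕ) := Fin m → ℝ

/-- The index set for `(m+1) × (m+1)` matrices, split into blocks. -/
abbrev Idx (m : ℕ) := Sum (Fin m) Unit

/-- `gl(m,ℝ)`, realized as continuous linear endomorphisms of `ℝ^m`. -/
abbrev GLm (m : ℕ) := (Fin m → ℝ) →L[ℝ] (Fin m → ℝ)

/-- `ℝ^{m*}`. -/
abbrev Dualm (m : ℕ) := (Fin m → ℝ) →L[ℝ] ℝ

/-- The vector field `X^M` on `ℝ^m` attached to a matrix
`M = [[A, v], [ξ, a]] ∈ sl(m+1,ℝ)`, namely `X^M(x) = -v - A x + a x + ξ(x) x`. -/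
def projVF (m : ℕ) (M : Matrix (Idx m) (Idx m) ℝ) : Rm m → Rm m := fun x i =>
  -(M (Sum.inl i) (Sum.inr ())) - (∑ j, M (Sum.inl i) (Sum.inl j) * x j)
    + M (Sum.inr ()) (Sum.inr ()) * x i
    + (∑ j, M (Sum.inr ()) (Sum.inl j) * x j) * x i

/-- The Lie derivative of a `V`-valued function along a vector field `X`, with respect to a
representation `σ` of `gl(m,ℝ)` on `V`:  `(L_X f)(x) = Df(x)[X(x)] - σ(DX(x))(f(x))`. -/
def lieD (m : ℕ) {V : Type} [NormedAddCommGroup V] [NormedSpace ℝ V]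
    (σ : GLm m → V → V) (X : Rm m → Rm m) (f : Rm m → V) : Rm m → V :=
  fun x => fderiv ℝ f x (X x) - σ (fderiv ℝ X x) (f x)

/-- `σ` is a Lie algebra representation of `gl(m,ℝ)`. -/
def IsLieRep (m : ℕ) {V : Type} [NormedAddCommGroup V] [NormedSpace ℝ V]
    (σ : GLm m →ₗ[ℝ] (V →L[ℝ] V)) : Prop :=
  ∀ A B : GLm m, σ (A ∘L B - B ∘L A) = σ A ∘L σ B - σ B ∘L σ A


/-- Iterated Lie derivative along the constant fields `X^{hᵢ} = -hᵢ`, outermost first. -/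
def lieItC (m : ℕ) {V : Type} [NormedAddCommGroup V] [NormedSpace ℝ V]
    (σ : GLm m → V → V) : (k : ℕ) → (Fin k → Rm m) → (Rm m → V) → (Rm m → V)
  | 0, _, f => f
  | (k+1), v, f => lieD m σ (fun _ => -(v 0)) (lieItC m σ k (fun j => v j.succ) f)

section Symbols

variable (m : ℕ) (V₁ V₂ : Type)
  [NormedAddCommGroup V₁] [NormedSpace ℝ V₁] [NormedAddCommGroup V₂] [NormedSpace ℝ V₂]

/-- The model for `S^k ℝ^m ⊗ Hom(V₁,V₂)`: multilinear maps on `k` copies of `ℝ^{m*}`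
with values in `Hom(V₁,V₂)` (symbols of degree `k` are the symmetric ones). -/
abbrev Symb (k : ℕ) := ContinuousMultilinearMap ℝ (fun _ : Fin k => Dualm m) (V₁ →L[ℝ] V₂)

/-- The decomposable tensor `h₁ ⊗ ⋯ ⊗ h_k ⊗ A` in the model. -/
def pureT {k : ℕ} (v : Fin k → Rm m) (A : V₁ →L[ℝ] V₂) : Symb m V₁ V₂ k :=
  (ContinuousMultilinearMap.mkPiRing ℝ (Fin k) A).compContinuousLinearMap
    (fun i => ContinuousLinearMap.apply ℝ ℝ (v i))

/-- The symmetric product `h₁ ∨ ⋯ ∨ h_k ⊗ A` in the model. -/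
def symT {k : ℕ} (v : Fin k → Rm m) (A : V₁ →L[ℝ] V₂) : Symb m V₁ V₂ k :=
  ∑ ν : Equiv.Perm (Fin k), pureT m V₁ V₂ (v ∘ ν) A

/-- The subspace of the model corresponding to `S^k ℝ^m ⊗ Hom(V₁,V₂)` itself:
the span of the symmetric products. -/
def spanGen (k : ℕ) : Submodule ℝ (Symb m V₁ V₂ k) :=
  Submodule.span ℝ {T | ∃ (v : Fin k → Rm m) (A : V₁ →L[ℝ] V₂), T = symT m V₁ V₂ v A}

/-- The rank-one endomorphism `u ⊗ h : x ↦ h(x) • u` of `ℝ^m`. -/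
def rkOne (u : Rm m) (h : Dualm m) : GLm m := h.smulRight u

variable (σ₁ : GLm m →ₗ[ℝ] (V₁ →L[ℝ] V₁)) (σ₂ : GLm m →ₗ[ℝ] (V₂ →L[ℝ] V₂))

/-- The representation `σ^{(k)}` of `gl(m,ℝ)` on `S^k ℝ^m ⊗ Hom(V₁,V₂)`, determined by
`σ^{(k)}(B)(h₁∨⋯∨h_k ⊗ A) = Σᵢ h₁∨⋯∨(B hᵢ)∨⋯∨h_k ⊗ A + h₁∨⋯∨h_k ⊗ (σ₂(B)∘A - A∘σ₁(B))`. -/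
def sigmaS {k : ℕ} (B : GLm m) (T : Symb m V₁ V₂ k) : Symb m V₁ V₂ k :=
  (∑ t : Fin k, T.compContinuousLinearMap
    (fun s => if s = t then (ContinuousLinearMap.compL ℝ (Rm m) (Rm m) ℝ).flip B
      else ContinuousLinearMap.id ℝ (Dualm m)))
  + ((ContinuousLinearMap.compL ℝ V₁ V₂ V₂ (σ₂ B))
      - (ContinuousLinearMap.compL ℝ V₁ V₁ V₂).flip (σ₁ B)).compContinuousMultilinearMap T

/-- The `i`-th coordinate covector on `ℝ^m`. -/
def coordD (i : Fin m) : Dualm m := ContinuousLinearMap.proj i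

/-- The affine quantization (standard ordering): the full contraction of a degree-`k` symbol
with the `k`-th derivative, `Q_Aff(h₁∨⋯∨h_k ⊗ A)(f) = A(∂_{h₁} ⋯ ∂_{h_k} f)`. -/
def QAff {k : ℕ} (T : Rm m → Symb m V₁ V₂ k) (f : Rm m → V₁) : Rm m → V₂ :=
  fun x => (k.factorial : ℝ)⁻¹ • ∑ d : Fin k → Fin m,
    (T x (fun t => coordD m (d t))) (iteratedFDeriv ℝ k f x (fun t => Pi.single (d t) 1))

/-- The defining property of the map `γ(h) : S^{k+1} ℝ^m ⊗ Hom(V₁,V₂) → S^k ℝ^m ⊗ Hom(V₁,V₂)`,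
for `h ∈ ℝ^{m*} ≅ 𝔤₁`:
`γ(h)(h₁∨⋯∨h_{k+1} ⊗ A) = Σᵢ h₁∨⋯(omit hᵢ)⋯∨h_{k+1} ⊗ (A ∘ σ₁(hᵢ⊗h + h(hᵢ)·Id))`
`- Σᵢ Σ_{j<i} h₁∨⋯(omit hⱼ,hᵢ)⋯∨h_{k+1} ∨ (h(hⱼ)·hᵢ + h(hᵢ)·hⱼ) ⊗ A`. -/
def gammaProp {k : ℕ}
    (γ : Dualm m → (Symb m V₁ V₂ (k+1) →ₗ[ℝ] Symb m V₁ V₂ k)) : Prop :=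
  ∀ (h : Dualm m) (v : Fin (k+1) → Rm m) (A : V₁ →L[ℝ] V₂),
    γ h (symT m V₁ V₂ v A) =
      (∑ i : Fin (k+1), symT m V₁ V₂ (i.removeNth v)
        (A.comp (σ₁ (rkOne m (v i) h + h (v i) • ContinuousLinearMap.id ℝ (Rm m)))))
      - ∑ i : Fin (k+1), ∑ j : Fin k,
          if (i.succAbove j : ℕ) < (i : ℕ) then
            symT m V₁ V₂ (i.removeNth (Function.update v (i.succAbove j)
              (h (v (i.succAbove j)) • v i + h (v i) • v (i.succAbove j)))) A
          else 0

/-- The model for `⊕_{k=0}^K S^k ℝ^m ⊗ Hom(V₁,V₂)`. -/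
abbrev SymbT (K : ℕ) := ∀ k : Fin (K+1), Symb m V₁ V₂ (k : ℕ)

/-- The degree-wise representation `⊕_k σ^{(k)}` on `⊕_{k=0}^K S^k ℝ^m ⊗ Hom(V₁,V₂)`. -/
def sigmaT {K : ℕ} (B : GLm m) (T : SymbT m V₁ V₂ K) : SymbT m V₁ V₂ K :=
  fun k => sigmaS m V₁ V₂ σ₁ σ₂ B (T k)

/-- The extension of a family `γ` to `⊕_{k=0}^K S^k ℝ^m ⊗ Hom(V₁,V₂)` (lowering degree). -/
def gTot {K : ℕ} (γf : ∀ k : ℕ, Dualm m → (Symb m V₁ V₂ (k+1) →ₗ[ℝ] Symb m V₁ V₂ k))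
    (h : Dualm m) (T : SymbT m V₁ V₂ K) : SymbT m V₁ V₂ K :=
  fun k => if hk : (k : ℕ) + 1 < K + 1 then γf (k : ℕ) h (T ⟨(k : ℕ) + 1, hk⟩) else 0


/-- The action `ρ^{(k)}(a) = S^k a ⊗ (Φ ↦ ρ₂(a)∘Φ∘ρ₁(a)⁻¹)` of `GL(m,ℝ)` on
`S^k ℝ^m ⊗ Hom(V₁,V₂)`, in the model. -/
def rhoK {k : ℕ} (a : (Fin m → ℝ) ≃L[ℝ] (Fin m → ℝ)) (r₁ : V₁ ≃L[ℝ] V₁) (r₂ : V₂ ≃L[ℝ] V₂)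
    (T : Symb m V₁ V₂ k) : Symb m V₁ V₂ k :=
  ((ContinuousLinearMap.compL ℝ V₁ V₂ V₂ (r₂ : V₂ →L[ℝ] V₂)) ∘L
    ((ContinuousLinearMap.compL ℝ V₁ V₁ V₂).flip
      ((r₁.symm : V₁ →L[ℝ] V₁)))).compContinuousMultilinearMap
    (T.compContinuousLinearMap
      (fun _ => (ContinuousLinearMap.compL ℝ (Rm m) (Rm m) ℝ).flip
        (a : (Fin m → ℝ) →L[ℝ] (Fin m → ℝ))))

end Symbols

section Matrices

variable (m : ℕ)

/-- The element of `𝔤₁ ⊂ sl(m+1,ℝ)` with `ξ`-block the covector `h`. -/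
def hMat (h : Dualm m) : Matrix (Idx m) (Idx m) ℝ :=
  Matrix.fromBlocks 0 0 (Matrix.of fun _ j => h (Pi.single j 1)) 0

/-- The element of `𝔤₋₁ ⊂ sl(m+1,ℝ)` with `v`-block the vector `X`. -/
def XMat (X : Rm m) : Matrix (Idx m) (Idx m) ℝ :=
  Matrix.fromBlocks 0 (Matrix.of fun i _ => X i) 0 0

/-- The lift `B̃ ∈ 𝔤₀ ⊂ sl(m+1,ℝ)` of `B ∈ gl(m,ℝ)`, with `ψ(B̃) = B`. -/
def BTilde (B : GLm m) : Matrix (Idx m) (Idx m) ℝ :=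
  Matrix.fromBlocks
    (LinearMap.toMatrix' (B : (Fin m → ℝ) →ₗ[ℝ] (Fin m → ℝ))
      - ((LinearMap.trace ℝ (Rm m) (B : (Fin m → ℝ) →ₗ[ℝ] (Fin m → ℝ))) / ((m : ℝ) + 1)) • 1)
    0 0
    (Matrix.of fun _ _ => -(LinearMap.trace ℝ (Rm m) (B : (Fin m → ℝ) →ₗ[ℝ] (Fin m → ℝ))) / ((m : ℝ) + 1))

/-- The map `ψ : 𝔤₀ → gl(m,ℝ) : [[A,0],[0,a]] ↦ A - a·Id`. -/
def psiC (M : Matrix (Idx m) (Idx m) ℝ) : GLm m :=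
  LinearMap.toContinuousLinearMap
    ((Matrix.of fun i j => M (Sum.inl i) (Sum.inl j)).mulVecLin
      - M (Sum.inr ()) (Sum.inr ()) • LinearMap.id)

/-- The basis `(eᵢ)` of `𝔤₋₁`, corresponding to the standard basis of `ℝ^m`. -/
def eMat (i : Fin m) : Matrix (Idx m) (Idx m) ℝ := XMat m (Pi.single i 1)

/-- The covector `εⁱ = (1/(2(m+1))) δⁱ ∈ ℝ^{m*}`. -/
def epsD (i : Fin m) : Dualm m := (1 / (2 * ((m : ℝ) + 1))) • coordD m i

/-- The basis `(εⁱ)` of `𝔤₁`, Killing-dual to `(eᵢ)`. -/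
def epsMat (i : Fin m) : Matrix (Idx m) (Idx m) ℝ := hMat m (epsD m i)

/-- The Euler element `E = diag(-1/(m+1), …, -1/(m+1), m/(m+1)) ∈ 𝔤₀`, with `ψ(E) = -Id`. -/
def EMat : Matrix (Idx m) (Idx m) ℝ :=
  Matrix.fromBlocks ((-(1 / ((m : ℝ) + 1))) • 1) 0 0 (Matrix.of fun _ _ => (m : ℝ) / ((m : ℝ) + 1))

/-- Membership in `𝔰 ≅ sl(m,ℝ) ⊂ 𝔤₀`: block diagonal with vanishing corner and traceless. -/
def inS (M : Matrix (Idx m) (Idx m) ℝ) : Prop :=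
  (∀ i, M (Sum.inl i) (Sum.inr ()) = 0) ∧ (∀ j, M (Sum.inr ()) (Sum.inl j) = 0) ∧
    M (Sum.inr ()) (Sum.inr ()) = 0 ∧ Matrix.trace M = 0

/-- Membership in `𝔤₋₁`: only the `v`-block is nonzero. -/
def inGm1 (M : Matrix (Idx m) (Idx m) ℝ) : Prop :=
  (∀ i j, M (Sum.inl i) (Sum.inl j) = 0) ∧ (∀ j, M (Sum.inr ()) (Sum.inl j) = 0) ∧
    M (Sum.inr ()) (Sum.inr ()) = 0

/-- Membership in `𝔤₁`: only the `ξ`-block is nonzero. -/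
def inG1 (M : Matrix (Idx m) (Idx m) ℝ) : Prop :=
  (∀ i j, M (Sum.inl i) (Sum.inl j) = 0) ∧ (∀ i, M (Sum.inl i) (Sum.inr ()) = 0) ∧
    M (Sum.inr ()) (Sum.inr ()) = 0

/-- Membership in `𝔤₀`: block diagonal. -/
def inG0 (M : Matrix (Idx m) (Idx m) ℝ) : Prop :=
  (∀ i, M (Sum.inl i) (Sum.inr ()) = 0) ∧ (∀ j, M (Sum.inr ()) (Sum.inl j) = 0)

/-- The Killing form of `sl(m+1,ℝ)`: `κ(M,N) = 2(m+1) tr(MN)`. -/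
def kappa (M N : Matrix (Idx m) (Idx m) ℝ) : ℝ := 2 * ((m : ℝ) + 1) * Matrix.trace (M * N)

end Matrices

section SymbolOperators

variable (m : ℕ) (V₁ V₂ : Type)
  [NormedAddCommGroup V₁] [NormedSpace ℝ V₁] [NormedAddCommGroup V₂] [NormedSpace ℝ V₂]
  (σ₁ : GLm m →ₗ[ℝ] (V₁ →L[ℝ] V₁)) (σ₂ : GLm m →ₗ[ℝ] (V₂ →L[ℝ] V₂))

/-- The operator `C₀ = (1/2)σ^{(k)}(Id) + (1/2m)σ^{(k)}(Id)² + Σ_s σ^{(k)}(ψ(h_s))∘σ^{(k)}(ψ(h_s^*))`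
on `S^k ℝ^m ⊗ Hom(V₁,V₂)`. -/
def C0op {k : ℕ} {n : ℕ} (hs hs' : Fin n → Matrix (Idx m) (Idx m) ℝ)
    (T : Symb m V₁ V₂ k) : Symb m V₁ V₂ k :=
  (1/2 : ℝ) • sigmaS m V₁ V₂ σ₁ σ₂ (ContinuousLinearMap.id ℝ (Rm m)) T
  + (1/(2*(m : ℝ))) • sigmaS m V₁ V₂ σ₁ σ₂ (ContinuousLinearMap.id ℝ (Rm m))
      (sigmaS m V₁ V₂ σ₁ σ₂ (ContinuousLinearMap.id ℝ (Rm m)) T)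
  + ∑ s, sigmaS m V₁ V₂ σ₁ σ₂ (psiC m (hs s)) (sigmaS m V₁ V₂ σ₁ σ₂ (psiC m (hs' s)) T)

/-- `C₀` acting degreewise on `⊕_{k=0}^K S^k ℝ^m ⊗ Hom(V₁,V₂)`. -/
def C0tot {K : ℕ} {n : ℕ} (hs hs' : Fin n → Matrix (Idx m) (Idx m) ℝ)
    (T : SymbT m V₁ V₂ K) : SymbT m V₁ V₂ K :=
  fun k => C0op m V₁ V₂ σ₁ σ₂ hs hs' (T k)

/-- The operator `𝓛_M = L_{X^M} + γ(ξ_M)` (flat curly Lie derivative) on functions with values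
in `⊕_{k=0}^K S^k ℝ^m ⊗ Hom(V₁,V₂)`, where `ξ_M` is the `𝔤₁`-component of `M`. -/
def curlyL {K : ℕ} (γf : ∀ k : ℕ, Dualm m → (Symb m V₁ V₂ (k+1) →ₗ[ℝ] Symb m V₁ V₂ k))
    (M : Matrix (Idx m) (Idx m) ℝ) (f : Rm m → SymbT m V₁ V₂ K) : Rm m → SymbT m V₁ V₂ K :=
  fun x => lieD m (fun B T => sigmaT m V₁ V₂ σ₁ σ₂ B T) (projVF m M) f x
    + gTot m V₁ V₂ γf (∑ j, M (Sum.inr ()) (Sum.inl j) • coordD m j) (f x)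

end SymbolOperators

section Curved

variable (m : ℕ) (P : Type) [NormedAddCommGroup P] [NormedSpace ℝ P]

/-- The invariant derivative `L_{ω^{-1}(Z)} f` along the `ω`-constant vector field `η Z`. -/
def LD (η : Matrix (Idx m) (Idx m) ℝ → P → P) (Z : Matrix (Idx m) (Idx m) ℝ)
    {V : Type} [NormedAddCommGroup V] [NormedSpace ℝ V] (f : P → V) : P → V :=
  fun u => fderiv ℝ f u (η Z u)

/-- The bracket compatibility satisfied by a normal Cartan connection: for `M ∈ 𝔤₀ ⊕ 𝔤₁` and
`N ∈ 𝔤₋₁`, `L_{ω^{-1}(M)} ∘ L_{ω^{-1}(N)} - L_{ω^{-1}(N)} ∘ L_{ω^{-1}(M)} = L_{ω^{-1}([M,N])}` on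
smooth vector-space-valued functions. -/
def BracketCompat (η : Matrix (Idx m) (Idx m) ℝ → P → P) : Prop :=
  ∀ (V : Type) [NormedAddCommGroup V] [NormedSpace ℝ V],
    ∀ f : P → V, ContDiff ℝ (⊤ : ℕ∞) f →
      ∀ M N : Matrix (Idx m) (Idx m) ℝ, Matrix.trace M = 0 → Matrix.trace N = 0 →
        (∀ i, M (Sum.inl i) (Sum.inr ()) = 0) → inGm1 m N →
        (LD m P η M (LD m P η N f) - LD m P η N (LD m P η M f)) = LD m P η (M * N - N * M) f

/-- Infinitesimal `G₀`-equivariance of `f : P → V` with respect to `σ`: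
`L_{ω^{-1}(B̃)} f = -σ(B) f` for all `B ∈ gl(m,ℝ)`. -/
def equivG0 (η : Matrix (Idx m) (Idx m) ℝ → P → P)
    {V : Type} [NormedAddCommGroup V] [NormedSpace ℝ V]
    (σ : GLm m → V → V) (f : P → V) : Prop :=
  ∀ B : GLm m, LD m P η (BTilde m B) f = fun u => -(σ B (f u))

/-- Iterated invariant derivatives along `𝔤₋₁`-constant fields. -/
def iterL (η : Matrix (Idx m) (Idx m) ℝ → P → P)
    {V : Type} [NormedAddCommGroup V] [NormedSpace ℝ V] :
    (k : ℕ) → (Fin k → Rm m) → (P → V) → (P → V)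
  | 0, _, f => f
  | (k+1), v, f => LD m P η (XMat m (v 0)) (iterL η k (fun j => v j.succ) f)

/-- The symmetrized iterated invariant differential `(∇^ω)^k f`, evaluated on
`(X₁, …, X_k) ∈ (ℝ^m)^k`. -/
def nabK (η : Matrix (Idx m) (Idx m) ℝ → P → P)
    {V : Type} [NormedAddCommGroup V] [NormedSpace ℝ V]
    (k : ℕ) (f : P → V) (v : Fin k → Rm m) : P → V :=
  fun u => (k.factorial : ℝ)⁻¹ • ∑ ν : Equiv.Perm (Fin k), iterL m P η k (v ∘ ν) f u

variable (V₁ V₂ : Type)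
  [NormedAddCommGroup V₁] [NormedSpace ℝ V₁] [NormedAddCommGroup V₂] [NormedSpace ℝ V₂]

/-- The curved quantization map: `Q_ω(T)(f)(u) = ⟨T(u), (∇^ω)^k f(u)⟩` (full contraction). -/
def Qom (η : Matrix (Idx m) (Idx m) ℝ → P → P) {k : ℕ}
    (T : P → Symb m V₁ V₂ k) (f : P → V₁) : P → V₂ :=
  fun u => (k.factorial : ℝ)⁻¹ • ∑ d : Fin k → Fin m,
    (T u (fun t => coordD m (d t))) (nabK m P η k f (fun t => Pi.single (d t) 1) u)


/-- The curved operator `N^ω f = -2 Σᵢ γ(εⁱ)(L_{ω^{-1}(eᵢ)} f)`. -/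
def Nom {K : ℕ} (γf : ∀ k : ℕ, Dualm m → (Symb m V₁ V₂ (k+1) →ₗ[ℝ] Symb m V₁ V₂ k))
    (η : Matrix (Idx m) (Idx m) ℝ → P → P) (f : P → SymbT m V₁ V₂ K) : P → SymbT m V₁ V₂ K :=
  fun u => (-2 : ℝ) • ∑ i : Fin m, gTot m V₁ V₂ γf (epsD m i)
    (LD m P η (XMat m (Pi.single i 1)) f u)

end Curved


section AffineFields

variable {E F : Type*} [NormedAddCommGroup E] [NormedSpace ℝ E]
  [NormedAddCommGroup F] [NormedSpace ℝ F]

theorem contDiff_of_hasFDerivAt_const {X : E → F} {B : E →L[ℝ] F}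
    (hX : ∀ x, HasFDerivAt X B x) : ContDiff ℝ (⊤ : ℕ∞) X := by
  have hB : fderiv ℝ X = fun _ => B := funext fun y => (hX y).fderiv
  rw [contDiff_infty_iff_fderiv]
  exact ⟨fun y => (hX y).differentiableAt, by rw [hB]; exact contDiff_const⟩

theorem iteratedFDeriv_succ_apply_fderiv_apply {f : E → F} (hf : ContDiff ℝ (⊤ : ℕ∞) f)
    (k : ℕ) (x : E) (v : Fin (k + 1) → E) :
    iteratedFDeriv ℝ (k + 1) f x v =
      iteratedFDeriv ℝ k (fun y => fderiv ℝ f y (v (Fin.last k))) x (Fin.init v) := by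
  have hdf : ContDiff ℝ (⊤ : ℕ∞) (fderiv ℝ f) := hf.fderiv_right (by simp)
  have h := (ContinuousLinearMap.apply ℝ F (v (Fin.last k))).iteratedFDeriv_comp_left
    (hdf.contDiffAt (x := x)) (i := k) (by exact_mod_cast le_top)
  rw [iteratedFDeriv_succ_apply_right]
  change _ = iteratedFDeriv ℝ k
    (ContinuousLinearMap.apply ℝ F (v (Fin.last k)) ∘ fderiv ℝ f) x (Fin.init v)
  rw [h]
  rfl

/-- Differentiating the derivative of `f` along an affine vector field with linear part `B`. -/
theorem iteratedFDeriv_fderiv_apply_affine {X : E → E} {B : E →L[ℝ] E}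
    (hX : ∀ x, HasFDerivAt X B x) (k : ℕ) (x : E) :
    ∀ (f : E → F), ContDiff ℝ (⊤ : ℕ∞) f → ∀ v : Fin k → E,
    iteratedFDeriv ℝ k (fun y => fderiv ℝ f y (X y)) x v =
      iteratedFDeriv ℝ (k + 1) f x (Fin.cons (X x) v)
        + ∑ t, iteratedFDeriv ℝ k f x (Function.update v t (B (v t))) := by
  have hXs : ContDiff ℝ (⊤ : ℕ∞) X := contDiff_of_hasFDerivAt_const hX
  induction k with
  | zero =>
    intro f hf v
    rw [iteratedFDeriv_succ_apply_fderiv_apply hf]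
    simp only [iteratedFDeriv_zero_apply, Finset.univ_eq_empty, Finset.sum_empty, add_zero]
    rfl
  | succ k ih =>
    intro f hf v
    have hdf : ContDiff ℝ (⊤ : ℕ∞) (fderiv ℝ f) := hf.fderiv_right (by simp)
    have hdir : ∀ w, ContDiff ℝ (⊤ : ℕ∞) (fun y => fderiv ℝ f y w) :=
      fun w => hdf.clm_apply contDiff_const
    set w := v (Fin.last k)
    have key : (fun y => fderiv ℝ (fun y => fderiv ℝ f y (X y)) y w)
        = (fun y => fderiv ℝ (fun z => fderiv ℝ f z w) y (X y))
          + fun y => fderiv ℝ f y (B w) := by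
      funext y
      have hd : DifferentiableAt ℝ (fderiv ℝ f) y := hdf.differentiable (by simp) y
      have hs : IsSymmSndFDerivAt ℝ f y :=
        hf.contDiffAt.isSymmSndFDerivAt (by
          rw [minSmoothness_of_isRCLikeNormedField]
          exact WithTop.coe_le_coe.2 (le_top : (2 : ℕ∞) ≤ ⊤))
      rw [(hd.hasFDerivAt.clm_apply (hX y)).fderiv]
      rw [Pi.add_apply, (hd.hasFDerivAt.clm_apply (hasFDerivAt_const w y)).fderiv]
      simp [hs w (X y), add_comm]
    rw [iteratedFDeriv_succ_apply_fderiv_apply (hdf.clm_apply hXs), key,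
      iteratedFDeriv_add_apply
        ((((hdir w).fderiv_right (m := (⊤ : ℕ∞)) (by simp)).clm_apply
          hXs).contDiffAt.of_le (by exact_mod_cast le_top))
        ((hdir (B w)).contDiffAt.of_le (by exact_mod_cast le_top)),
      _root_.add_apply, ih _ (hdir w), Fin.sum_univ_castSucc,
      iteratedFDeriv_succ_apply_fderiv_apply hf (k + 1) x, add_assoc]
    congr 1
    congr 1
    · refine Finset.sum_congr rfl fun t _ => ?_
      rw [iteratedFDeriv_succ_apply_fderiv_apply hf k x, Fin.init_update_castSucc,
        Function.update_of_ne (Fin.castSucc_lt_last t).ne']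
      rfl
    · rw [iteratedFDeriv_succ_apply_fderiv_apply hf k x, Fin.init_update_last,
        Function.update_self]

end AffineFields

section Contraction

variable {m k : ℕ} {V₁ V₂ : Type}
  [NormedAddCommGroup V₁] [NormedSpace ℝ V₁] [NormedAddCommGroup V₂] [NormedSpace ℝ V₂]

theorem coordD_comp (B : GLm m) (i : Fin m) :
    (coordD m i).comp B = ∑ j, (B (Pi.single j 1)) i • coordD m j := by
  ext x
  conv_lhs => rw [pi_eq_sum_univ' x]
  simp [coordD, mul_comm]

/-- In the full contraction, an endomorphism may be moved from one factor to the other. -/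
theorem sum_contraction_comp_eq (B : GLm m) (S : Symb m V₁ V₂ k)
    (N : ContinuousMultilinearMap ℝ (fun _ : Fin k => Rm m) V₁) (t : Fin k) :
    ∑ d : Fin k → Fin m, (S (Function.update (fun s => coordD m (d s)) t
        ((coordD m (d t)).comp B))) (N fun s => Pi.single (d s) 1)
      = ∑ d : Fin k → Fin m, (S fun s => coordD m (d s))
          (N (Function.update (fun s => Pi.single (d s) 1) t (B (Pi.single (d t) 1)))) := by
  have hB : ∀ j, B (Pi.single j 1) = ∑ i, (B (Pi.single j 1)) i • (Pi.single i 1 : Rm m) :=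
    fun j => pi_eq_sum_univ' _
  have hL : ∀ d : Fin k → Fin m, (S (Function.update (fun s => coordD m (d s)) t
        ((coordD m (d t)).comp B))) (N fun s => Pi.single (d s) 1)
      = ∑ j, (B (Pi.single j 1)) (d t) •
        (S fun s => coordD m (Function.update d t j s)) (N fun s => Pi.single (d s) 1) := by
    intro d
    have h := S.toMultilinearMap.map_update_sum Finset.univ t
      (fun j => (B (Pi.single j 1)) (d t) • coordD m j) (fun s => coordD m (d s))
    simp only [ContinuousMultilinearMap.coe_coe] at h
    rw [coordD_comp, h, _root_.sum_apply]
    refine Finset.sum_congr rfl fun j _ => ?_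
    rw [S.map_update_smul, _root_.smul_apply]
    congr 3
    funext s
    by_cases h : s = t
    · subst h; simp
    · simp [h]
  have hR : ∀ d : Fin k → Fin m, (S fun s => coordD m (d s))
          (N (Function.update (fun s => Pi.single (d s) 1) t (B (Pi.single (d t) 1))))
      = ∑ i, (B (Pi.single (d t) 1)) i •
        (S fun s => coordD m (d s)) (N fun s => Pi.single (Function.update d t i s) 1) := by
    intro d
    have h := N.toMultilinearMap.map_update_sum Finset.univ t
      (fun i => (B (Pi.single (d t) 1)) i • (Pi.single i 1 : Rm m)) (fun s => Pi.single (d s) 1)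
    simp only [ContinuousMultilinearMap.coe_coe] at h
    rw [← hB] at h
    rw [h, map_sum]
    refine Finset.sum_congr rfl fun j _ => ?_
    rw [N.map_update_smul, map_smul]
    congr 3
    funext s
    by_cases h : s = t
    · subst h; simp
    · simp [h]
  simp_rw [hL, hR, ← Fintype.sum_prod_type']
  let φ : (Fin k → Fin m) × Fin m → (Fin k → Fin m) × Fin m :=
    fun p => (Function.update p.1 t p.2, p.1 t)
  have hφ : Function.Involutive φ := fun p => by simp [φ]
  refine Fintype.sum_equiv hφ.toPerm _ _ fun p => ?_
  simp [φ, Function.Involutive.toPerm]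

end Contraction

section Quantization

variable {m k : ℕ} {V₁ V₂ : Type}
  [NormedAddCommGroup V₁] [NormedSpace ℝ V₁] [NormedAddCommGroup V₂] [NormedSpace ℝ V₂]

theorem exists_hasFDerivAt_projVF {M : Matrix (Idx m) (Idx m) ℝ}
    (hM : ∀ j, M (Sum.inr ()) (Sum.inl j) = 0) :
    ∃ B : GLm m, ∀ x, HasFDerivAt (projVF m M) B x := by
  refine ⟨-psiC m M, fun x => ?_⟩
  have h : projVF m M = fun y => (-psiC m M) y + fun i => -(M (Sum.inl i) (Sum.inr ())) := by
    funext y i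
    simp only [projVF, hM, psiC, _root_.neg_apply, Pi.add_apply, Pi.neg_apply,
      LinearMap.coe_toContinuousLinearMap', LinearMap.sub_apply, LinearMap.smul_apply,
      Matrix.mulVecLin_apply, Pi.sub_apply, Pi.smul_apply, Matrix.mulVec, dotProduct,
      Matrix.of_apply, LinearMap.id_apply, smul_eq_mul, zero_mul, Finset.sum_const_zero]
    ring
  rw [h]
  exact (-psiC m M).hasFDerivAt.add_const _

theorem sigmaS_apply (σ₁ : GLm m →ₗ[ℝ] (V₁ →L[ℝ] V₁)) (σ₂ : GLm m →ₗ[ℝ] (V₂ →L[ℝ] V₂))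
    (B : GLm m) (S : Symb m V₁ V₂ k) (a : Fin k → Dualm m) (u : V₁) :
    sigmaS m V₁ V₂ σ₁ σ₂ B S a u =
      (∑ t, S (Function.update a t ((a t).comp B)) u) + (σ₂ B (S a u) - S a (σ₁ B u)) := by
  have h : ∀ t : Fin k, (fun s => (if s = t then
      (ContinuousLinearMap.compL ℝ (Rm m) (Rm m) ℝ).flip B
      else ContinuousLinearMap.id ℝ (Dualm m)) (a s)) = Function.update a t ((a t).comp B) := by
    intro t
    funext s
    by_cases hs : s = t
    · subst hs; simp
    · simp [hs]
  simp [sigmaS, h]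

theorem fderiv_QAff_apply {T : Rm m → Symb m V₁ V₂ k} (hT : ContDiff ℝ (⊤ : ℕ∞) T)
    {f : Rm m → V₁} (hf : ContDiff ℝ (⊤ : ℕ∞) f) (x w : Rm m) :
    fderiv ℝ (QAff m V₁ V₂ T f) x w = (k.factorial : ℝ)⁻¹ • ∑ d : Fin k → Fin m,
      ((fderiv ℝ T x w fun t => coordD m (d t))
          (iteratedFDeriv ℝ k f x fun t => Pi.single (d t) 1)
        + (T x fun t => coordD m (d t))
          (iteratedFDeriv ℝ (k + 1) f x (Fin.cons w fun t => Pi.single (d t) 1))) := by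
  have hTd : HasFDerivAt T (fderiv ℝ T x) x := (hT.differentiable (by simp) x).hasFDerivAt
  have hfd : HasFDerivAt (iteratedFDeriv ℝ k f) (fderiv ℝ (iteratedFDeriv ℝ k f) x) x :=
    (hf.differentiable_iteratedFDeriv (by exact_mod_cast ENat.natCast_lt_top k) x).hasFDerivAt
  have hsum := (HasFDerivAt.fun_sum (u := Finset.univ) fun (d : Fin k → Fin m) _ =>
    (hTd.continuousMultilinear_apply_const fun t => coordD m (d t)).clm_apply
      (hfd.continuousMultilinear_apply_const fun t => Pi.single (d t) 1)).const_smul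
    (k.factorial : ℝ)⁻¹
  have h := congrArg (fun L => L w) hsum.fderiv
  refine Eq.trans h ?_
  simp [iteratedFDeriv_succ_apply_left, add_comm]

end Quantization

/-- the affine quantization intertwines Lie derivatives along `X^M` for
`M ∈ 𝔤₋₁ ⊕ 𝔤₀` (vanishing `ξ`-block), i.e. the cocycle `γ` vanishes on `𝔤₋₁ ⊕ 𝔤₀`. -/
theorem statement3 (m k : ℕ) (hm : 2 ≤ m)
    (V₁ V₂ : Type) [NormedAddCommGroup V₁] [NormedSpace ℝ V₁] [FiniteDimensional ℝ V₁]
    [NormedAddCommGroup V₂] [NormedSpace ℝ V₂] [FiniteDimensional ℝ V₂]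
    (σ₁ : GLm m →ₗ[ℝ] (V₁ →L[ℝ] V₁)) (hσ₁ : IsLieRep m σ₁)
    (σ₂ : GLm m →ₗ[ℝ] (V₂ →L[ℝ] V₂)) (hσ₂ : IsLieRep m σ₂)
    (M : Matrix (Idx m) (Idx m) ℝ) (hMtr : Matrix.trace M = 0)
    (hMxi : ∀ j, M (Sum.inr ()) (Sum.inl j) = 0)
    (T : Rm m → Symb m V₁ V₂ k) (hT : ContDiff ℝ (⊤ : ℕ∞) T)
    (hTval : ∀ x, T x ∈ spanGen m V₁ V₂ k)
    (f : Rm m → V₁) (hf : ContDiff ℝ (⊤ : ℕ∞) f) :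
    lieD m (fun B u => σ₂ B u) (projVF m M) (QAff m V₁ V₂ T f)
      = QAff m V₁ V₂ (lieD m (fun B S => sigmaS m V₁ V₂ σ₁ σ₂ B S) (projVF m M) T) f
        + QAff m V₁ V₂ T (lieD m (fun B u => σ₁ B u) (projVF m M) f) := by
  obtain ⟨B, hB⟩ := exists_hasFDerivAt_projVF hMxi
  set X := projVF m M
  have hXs : ContDiff ℝ (⊤ : ℕ∞) X := contDiff_of_hasFDerivAt_const hB
  funext x
  have hdf : ContDiff ℝ (⊤ : ℕ∞) (fderiv ℝ f) := hf.fderiv_right (by simp)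
  have hLf : ∀ v : Fin k → Rm m,
      iteratedFDeriv ℝ k (lieD m (fun B u => σ₁ B u) X f) x v =
        iteratedFDeriv ℝ (k + 1) f x (Fin.cons (X x) v)
          + ∑ t, iteratedFDeriv ℝ k f x (Function.update v t (B (v t)))
          - σ₁ B (iteratedFDeriv ℝ k f x v) := by
    intro v
    have h1 : lieD m (fun B u => σ₁ B u) X f = (fun y => fderiv ℝ f y (X y)) - σ₁ B ∘ f := by
      funext y
      simp [lieD, (hB y).fderiv]
    rw [h1, iteratedFDeriv_sub_apply
      ((hdf.clm_apply hXs).contDiffAt.of_le (by exact_mod_cast le_top))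
      (((σ₁ B).contDiff.comp hf).contDiffAt.of_le (by exact_mod_cast le_top)),
      _root_.sub_apply, iteratedFDeriv_fderiv_apply_affine hB k x f hf v,
      (σ₁ B).iteratedFDeriv_comp_left hf.contDiffAt (by exact_mod_cast le_top)]
    rfl
  have hswap := Finset.sum_congr rfl fun t (_ : t ∈ Finset.univ) =>
    sum_contraction_comp_eq B (T x) (iteratedFDeriv ℝ k f x) t
  rw [Finset.sum_comm, Finset.sum_comm (γ := Fin k)] at hswap
  rw [Pi.add_apply, lieD, fderiv_QAff_apply hT hf, (hB x).fderiv]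
  simp only [QAff, hLf]
  simp only [lieD, (hB x).fderiv, _root_.sub_apply, sigmaS_apply, map_smul, map_sum, map_add, map_sub]
  rw [← smul_sub, ← smul_add]
  congr 1
  simp only [Finset.sum_add_distrib, Finset.sum_sub_distrib]
  rw [hswap]
  abel

end ProjQuant
end
end

section
/- For every h ∈ ℝ^{m*} ≅ g₁ and every degree-k symbol T, the difference between the Lie derivative of the operator Q_Aff(T) and the quantization of the Lie derivative of T is the quantization of γ(h) applied pointwise to T: for every smooth f: ℝ^m → V₁, L_{X^h}(Q_Aff(T)f) − Q_Aff(T)(L_{X^h}f) − Q_Aff(L_{X^h}T)(f) = Q_Aff(γ(h)∘T)(f), where X^h is the quadratic vector field X^h(x) = h(x)·x. -/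
open scoped BigOperators
noncomputable section
namespace ProjQuant

section DirectionalDerivatives

variable {E F : Type*} [NormedAddCommGroup E] [NormedSpace ℝ E]
  [NormedAddCommGroup F] [NormedSpace ℝ F]

theorem contDiff_fderiv_apply {f : E → F} (hf : ContDiff ℝ (⊤ : ℕ∞) f) (u : E) :
    ContDiff ℝ (⊤ : ℕ∞) (fun y => fderiv ℝ f y u) :=
  (hf.fderiv_right (m := (⊤ : ℕ∞)) (by simp)).clm_apply contDiff_const

theorem contDiff_iteratedFDeriv {f : E → F} (hf : ContDiff ℝ (⊤ : ℕ∞) f) (n : ℕ) :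
    ContDiff ℝ (⊤ : ℕ∞) (iteratedFDeriv ℝ n f) :=
  hf.iteratedFDeriv_right (m := (⊤ : ℕ∞)) (i := n) (by exact_mod_cast le_top)

theorem contDiff_iteratedFDeriv_apply {f : E → F} (hf : ContDiff ℝ (⊤ : ℕ∞) f) {n : ℕ}
    (v : Fin n → E) : ContDiff ℝ (⊤ : ℕ∞) (fun y => iteratedFDeriv ℝ n f y v) :=
  (ContinuousMultilinearMap.apply ℝ (fun _ : Fin n => E) F v).contDiff.comp
    (contDiff_iteratedFDeriv hf n)

theorem fderiv_iteratedFDeriv_apply {f : E → F} (hf : ContDiff ℝ (⊤ : ℕ∞) f) {n : ℕ}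
    (v : Fin n → E) (x u : E) :
    fderiv ℝ (fun y => iteratedFDeriv ℝ n f y v) x u = fderiv ℝ (iteratedFDeriv ℝ n f) x u v := by
  have h := ((contDiff_iteratedFDeriv hf n).differentiable (by simp) x).hasFDerivAt
  have h' := (ContinuousMultilinearMap.apply ℝ (fun _ : Fin n => E) F v).hasFDerivAt.comp x h
  exact congrArg (fun L : E →L[ℝ] F => L u) h'.fderiv

theorem iteratedFDeriv_cons {f : E → F} (hf : ContDiff ℝ (⊤ : ℕ∞) f) {n : ℕ}
    (v : Fin n → E) (x u : E) :
    iteratedFDeriv ℝ (n + 1) f x (Fin.cons u v)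
      = fderiv ℝ (fun y => iteratedFDeriv ℝ n f y v) x u := by
  rw [fderiv_iteratedFDeriv_apply hf, iteratedFDeriv_succ_apply_left]
  simp

theorem fderiv_fderiv_comm {f : E → F} (hf : ContDiff ℝ (⊤ : ℕ∞) f) (x u w : E) :
    fderiv ℝ (fun y => fderiv ℝ f y u) x w = fderiv ℝ (fun y => fderiv ℝ f y w) x u := by
  have hd : DifferentiableAt ℝ (fderiv ℝ f) x :=
    (hf.fderiv_right (m := (⊤ : ℕ∞)) (by simp)).differentiable (by simp) x
  have hs : IsSymmSndFDerivAt ℝ f x :=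
    hf.contDiffAt.isSymmSndFDerivAt (by
      rw [minSmoothness_of_isRCLikeNormedField]; exact WithTop.coe_le_coe.2 le_top)
  have h (u w : E) : fderiv ℝ (fun y => fderiv ℝ f y u) x w = fderiv ℝ (fderiv ℝ f) x w u := by
    simp [fderiv_clm_apply hd (differentiableAt_const u)]
  rw [h, h, hs]

/-- Iterated directional derivative along a list of constant vectors, outermost first. -/
noncomputable def dirDeriv (f : E → F) : List E → E → F
  | [] => f
  | u :: l => fun x => fderiv ℝ (dirDeriv f l) x u

theorem contDiff_dirDeriv {f : E → F} (hf : ContDiff ℝ (⊤ : ℕ∞) f) (l : List E) :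
    ContDiff ℝ (⊤ : ℕ∞) (dirDeriv f l) := by
  induction l with
  | nil => exact hf
  | cons u l ih => exact contDiff_fderiv_apply ih u

theorem dirDeriv_perm {f : E → F} (hf : ContDiff ℝ (⊤ : ℕ∞) f) {l l' : List E}
    (hl : l.Perm l') : dirDeriv f l = dirDeriv f l' := by
  induction hl with
  | nil => rfl
  | cons u _ ih => simp only [dirDeriv, ih]
  | swap u w l => exact funext fun x => fderiv_fderiv_comm (contDiff_dirDeriv hf l) x u w
  | trans _ _ ih ih' => exact ih.trans ih'

theorem iteratedFDeriv_eq_dirDeriv {f : E → F} (hf : ContDiff ℝ (⊤ : ℕ∞) f) {n : ℕ}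
    (v : Fin n → E) (x : E) : iteratedFDeriv ℝ n f x v = dirDeriv f (List.ofFn v) x := by
  induction n generalizing x with
  | zero => simp [dirDeriv]
  | succ n ih =>
    induction v using Fin.consCases with
    | cons u v =>
      rw [iteratedFDeriv_cons hf, List.ofFn_cons, dirDeriv]
      simp only [ih]

theorem iteratedFDeriv_comp_perm {f : E → F} (hf : ContDiff ℝ (⊤ : ℕ∞) f) {n : ℕ}
    (v : Fin n → E) (x : E) (ν : Equiv.Perm (Fin n)) :
    iteratedFDeriv ℝ n f x (v ∘ ν) = iteratedFDeriv ℝ n f x v := by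
  rw [iteratedFDeriv_eq_dirDeriv hf, iteratedFDeriv_eq_dirDeriv hf,
    dirDeriv_perm hf (ν.ofFn_comp_perm v)]

theorem iteratedFDeriv_update {f : E → F} (hf : ContDiff ℝ (⊤ : ℕ∞) f) {n : ℕ}
    (v : Fin (n + 1) → E) (x w : E) (i : Fin (n + 1)) :
    iteratedFDeriv ℝ (n + 1) f x (Function.update v i w)
      = fderiv ℝ (fun y => iteratedFDeriv ℝ n f y (i.removeNth v)) x w := by
  rw [← iteratedFDeriv_cons hf,
    ← iteratedFDeriv_comp_perm hf (Fin.cons w (i.removeNth v)) x i.cycleRange,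
    Fin.cons_comp_cycleRange, Fin.insertNth_removeNth]

variable {X : E → E} {P : E →L[ℝ] E →L[ℝ] E}

theorem fderiv_fderiv_apply_field {f : E → F} (hf : ContDiff ℝ (⊤ : ℕ∞) f)
    {Z : E → E} {Z' : E →L[ℝ] E}
    {x : E} (hZ : HasFDerivAt Z Z' x) (u : E) :
    fderiv ℝ (fun y => fderiv ℝ f y (Z y)) x u
      = fderiv ℝ (fun y => fderiv ℝ f y u) x (Z x) + fderiv ℝ f x (Z' u) := by
  have hd : DifferentiableAt ℝ (fderiv ℝ f) x :=
    (hf.fderiv_right (m := (⊤ : ℕ∞)) (by simp)).differentiable (by simp) x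
  rw [fderiv_fderiv_comm hf, (hd.hasFDerivAt.clm_apply hZ).fderiv,
    (hd.hasFDerivAt.clm_apply (hasFDerivAt_const (Z x) x)).fderiv]
  simp [add_comm]

theorem contDiff_of_hasFDerivAt_clm (hX : ∀ y, HasFDerivAt X (P y) y) :
    ContDiff ℝ (⊤ : ℕ∞) X := by
  rw [contDiff_infty_iff_fderiv]
  refine ⟨fun y => (hX y).differentiableAt, ?_⟩
  rw [show fderiv ℝ X = P from funext fun y => (hX y).fderiv]
  exact P.contDiff

theorem contDiff_firstOrder (hX : ∀ y, HasFDerivAt X (P y) y) (B : E →L[ℝ] F →L[ℝ] F)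
    {f : E → F} (hf : ContDiff ℝ (⊤ : ℕ∞) f) :
    ContDiff ℝ (⊤ : ℕ∞) (fun y => fderiv ℝ f y (X y) - B y (f y)) :=
  ((hf.fderiv_right (m := (⊤ : ℕ∞)) (by simp)).clm_apply (contDiff_of_hasFDerivAt_clm hX)).sub
    (B.contDiff.clm_apply hf)

theorem fderiv_firstOrder (hX : ∀ y, HasFDerivAt X (P y) y) (B : E →L[ℝ] F →L[ℝ] F)
    {f : E → F} (hf : ContDiff ℝ (⊤ : ℕ∞) f) (x u : E) :
    fderiv ℝ (fun y => fderiv ℝ f y (X y) - B y (f y)) x u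
      = fderiv ℝ (fun y => fderiv ℝ f y u) x (X x) - B x (fderiv ℝ f x u)
        + fderiv ℝ f x (P x u) - B u (f x) := by
  have hd : DifferentiableAt ℝ f x := hf.differentiable (by simp) x
  have h1 : DifferentiableAt ℝ (fun y => fderiv ℝ f y (X y)) x :=
    ((hf.fderiv_right (m := (⊤ : ℕ∞)) (by simp)).clm_apply
      (contDiff_of_hasFDerivAt_clm hX)).differentiable (by simp) x
  have h2 := B.hasFDerivAt.clm_apply hd.hasFDerivAt (x := x)
  rw [fderiv_fun_sub h1 h2.differentiableAt, sub_apply,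
    fderiv_fderiv_apply_field hf (hX x), h2.fderiv]
  simp
  abel

/-- Leibniz formula for the iterated derivative of a first-order operator whose coefficients
are at most quadratic. -/
theorem iteratedFDeriv_firstOrder (hX : ∀ y, HasFDerivAt X (P y) y) (B : E →L[ℝ] F →L[ℝ] F)
    {f : E → F} (hf : ContDiff ℝ (⊤ : ℕ∞) f) {n : ℕ} (v : Fin (n + 1) → E) (x : E) :
    iteratedFDeriv ℝ (n + 1) (fun y => fderiv ℝ f y (X y) - B y (f y)) x v
      = fderiv ℝ (fun y => iteratedFDeriv ℝ (n + 1) f y v) x (X x)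
        - B x (iteratedFDeriv ℝ (n + 1) f x v)
        + (∑ i, fderiv ℝ (fun y => iteratedFDeriv ℝ n f y (i.removeNth v)) x (P x (v i)))
        - (∑ i, B (v i) (iteratedFDeriv ℝ n f x (i.removeNth v)))
        + ∑ i : Fin (n + 1), ∑ j : Fin n,
          if (i.succAbove j : ℕ) < (i : ℕ) then
            iteratedFDeriv ℝ n f x (i.removeNth (Function.update v (i.succAbove j)
              (P (v (i.succAbove j)) (v i))))
          else 0 := by
  have hg := contDiff_firstOrder hX B hf
  induction n generalizing x with
  | zero =>
    induction v using Fin.consCases with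
    | cons u v =>
      rw [iteratedFDeriv_cons hg]
      simp only [iteratedFDeriv_cons hf, iteratedFDeriv_zero_apply]
      rw [fderiv_firstOrder hX B hf]
      simp
  | succ n ih =>
    induction v using Fin.consCases with
    | cons u v =>
      rw [iteratedFDeriv_cons hg]
      simp only [ih]
      have hF := fun {n : ℕ} (w : Fin n → E) => contDiff_iteratedFDeriv_apply hf w
      have hFd := fun {n : ℕ} (w : Fin n → E) (y : E) =>
        ((hF w).differentiable (by simp) y)
      have hP : ∀ w y, HasFDerivAt (fun y => P y w) (P.flip w) y := fun w y =>
        (P.flip w).hasFDerivAt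
      have hA := contDiff_firstOrder hX B (hF v)
      have hS : ∀ i : Fin (n + 1), ContDiff ℝ (⊤ : ℕ∞) (fun y =>
          fderiv ℝ (fun y => iteratedFDeriv ℝ n f y (i.removeNth v)) y (P y (v i))) := fun i =>
        ((hF _).fderiv_right (m := (⊤ : ℕ∞)) (by simp)).clm_apply (P.flip (v i)).contDiff
      have hB : ∀ i : Fin (n + 1), ContDiff ℝ (⊤ : ℕ∞) (fun y =>
          B (v i) (iteratedFDeriv ℝ n f y (i.removeNth v))) := fun i =>
        (B (v i)).contDiff.comp (hF _)
      have hQ : ∀ (i : Fin (n + 1)) (j : Fin n), ContDiff ℝ (⊤ : ℕ∞) (fun y =>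
          if (i.succAbove j : ℕ) < (i : ℕ) then
            iteratedFDeriv ℝ n f y (i.removeNth (Function.update v (i.succAbove j)
              (P (v (i.succAbove j)) (v i))))
          else 0) := fun i j => by
        split_ifs
        · exact hF _
        · exact contDiff_const
      have dA := hA.differentiable (by simp) x
      have dS := fun i => (hS i).differentiable (by simp) x
      have dB := fun i => (hB i).differentiable (by simp) x
      have dQ := fun i j => (hQ i j).differentiable (by simp) x
      have eS : ∀ i : Fin (n + 1), fderiv ℝ (fun y =>
          fderiv ℝ (fun y => iteratedFDeriv ℝ n f y (i.removeNth v)) y (P y (v i))) x u =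
          fderiv ℝ (fun y => iteratedFDeriv ℝ (n + 1) f y (Fin.cons u (i.removeNth v))) x
            (P x (v i))
          + iteratedFDeriv ℝ (n + 1) f x (Fin.cons (P u (v i)) (i.removeNth v)) := fun i => by
        rw [fderiv_fderiv_apply_field (hF _) (hP _ _)]
        simp only [iteratedFDeriv_cons hf, ContinuousLinearMap.flip_apply]
      have eB : ∀ i : Fin (n + 1), fderiv ℝ (fun y =>
          B (v i) (iteratedFDeriv ℝ n f y (i.removeNth v))) x u =
          B (v i) (iteratedFDeriv ℝ (n + 1) f x (Fin.cons u (i.removeNth v))) := fun i => by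
        rw [iteratedFDeriv_cons hf]
        exact congrArg (fun L : E →L[ℝ] F => L u)
          ((B (v i)).hasFDerivAt.comp x (hFd (i.removeNth v) x).hasFDerivAt).fderiv
      have eQ : ∀ (i : Fin (n + 1)) (j : Fin n), fderiv ℝ (fun y =>
          if (i.succAbove j : ℕ) < (i : ℕ) then
            iteratedFDeriv ℝ n f y (i.removeNth (Function.update v (i.succAbove j)
              (P (v (i.succAbove j)) (v i))))
          else 0) x u = if (i.succAbove j : ℕ) < (i : ℕ) then
            iteratedFDeriv ℝ (n + 1) f x (Fin.cons u (i.removeNth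
              (Function.update v (i.succAbove j) (P (v (i.succAbove j)) (v i)))))
          else 0 := fun i j => by
        split_ifs
        · rw [iteratedFDeriv_cons hf]
        · simp
      have hrem : ∀ (i : Fin (n + 1)) (w : Fin (n + 1) → E) (a : E),
          i.succ.removeNth (Fin.cons a w : Fin (n + 2) → E) = Fin.cons a (i.removeNth w) :=
        fun i w a => Fin.cons_comp_succ_succAbove a w i
      rw [fderiv_fun_add (by fun_prop) (by fun_prop), fderiv_fun_sub (by fun_prop) (by fun_prop),
        fderiv_fun_add (by fun_prop) (by fun_prop), fderiv_fun_sum (by fun_prop),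
        fderiv_fun_sum (by fun_prop), fderiv_fun_sum (by fun_prop)]
      simp only [add_apply, sub_apply,
        sum_apply, eS, eB, fderiv_firstOrder hX B (hF v)]
      have hsum : ∀ i : Fin (n + 1), fderiv ℝ (fun y => ∑ j : Fin n,
          if (i.succAbove j : ℕ) < (i : ℕ) then
            iteratedFDeriv ℝ n f y (i.removeNth (Function.update v (i.succAbove j)
              (P (v (i.succAbove j)) (v i))))
          else 0) x u = ∑ j : Fin n, if (i.succAbove j : ℕ) < (i : ℕ) then
            iteratedFDeriv ℝ (n + 1) f x (Fin.cons u (i.removeNth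
              (Function.update v (i.succAbove j) (P (v (i.succAbove j)) (v i)))))
          else 0 := fun i => by
        rw [fderiv_fun_sum (fun j _ => dQ i j), sum_apply]
        exact Finset.sum_congr rfl fun j _ => eQ i j
      have hR1 : ∑ i : Fin (n + 2), fderiv ℝ (fun y => iteratedFDeriv ℝ (n + 1) f y
            (i.removeNth (Fin.cons u v : Fin (n + 2) → E))) x
            (P x ((Fin.cons u v : Fin (n + 2) → E) i))
          = fderiv ℝ (fun y => iteratedFDeriv ℝ (n + 1) f y v) x (P x u)
            + ∑ i : Fin (n + 1), fderiv ℝ (fun y => iteratedFDeriv ℝ (n + 1) f y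
              (Fin.cons u (i.removeNth v))) x (P x (v i)) := by
        rw [Fin.sum_univ_succ]
        simp only [Fin.removeNth_zero, Fin.tail_cons, Fin.cons_zero, Fin.cons_succ, hrem]
      have hR2 : ∑ i : Fin (n + 2), B ((Fin.cons u v : Fin (n + 2) → E) i)
            (iteratedFDeriv ℝ (n + 1) f x (i.removeNth (Fin.cons u v : Fin (n + 2) → E)))
          = B u (iteratedFDeriv ℝ (n + 1) f x v)
            + ∑ i : Fin (n + 1), B (v i)
              (iteratedFDeriv ℝ (n + 1) f x (Fin.cons u (i.removeNth v))) := by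
        rw [Fin.sum_univ_succ]
        simp only [Fin.removeNth_zero, Fin.tail_cons, Fin.cons_zero, Fin.cons_succ, hrem]
      have hR3 : (∑ i : Fin (n + 2), ∑ j : Fin (n + 1),
            if (i.succAbove j : ℕ) < (i : ℕ) then
              iteratedFDeriv ℝ (n + 1) f x (i.removeNth (Function.update
                (Fin.cons u v : Fin (n + 2) → E) (i.succAbove j)
                (P ((Fin.cons u v : Fin (n + 2) → E) (i.succAbove j))
                  ((Fin.cons u v : Fin (n + 2) → E) i))))
            else 0)
          = ∑ i : Fin (n + 1), (iteratedFDeriv ℝ (n + 1) f x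
              (Fin.cons (P u (v i)) (i.removeNth v))
            + ∑ j : Fin n, if (i.succAbove j : ℕ) < (i : ℕ) then
              iteratedFDeriv ℝ (n + 1) f x (Fin.cons u (i.removeNth
                (Function.update v (i.succAbove j) (P (v (i.succAbove j)) (v i)))))
              else 0) := by
        rw [Fin.sum_univ_succ]
        simp only [Fin.val_zero, not_lt_zero, if_false, Finset.sum_const_zero, zero_add]
        refine Finset.sum_congr rfl fun i _ => ?_
        rw [Fin.sum_univ_succ]
        simp only [Fin.succ_succAbove_zero, Fin.succ_succAbove_succ, Fin.update_cons_zero,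
          ← Fin.cons_update, hrem, Fin.cons_zero, Fin.cons_succ, Fin.val_zero, Fin.val_succ,
          Nat.succ_pos, if_true, add_lt_add_iff_right]
      rw [hR1, hR2, hR3]
      simp only [hsum, iteratedFDeriv_cons hf, Finset.sum_add_distrib]
      abel

end DirectionalDerivatives
section Contraction

variable (m : ℕ) (V₁ V₂ : Type)
  [NormedAddCommGroup V₁] [NormedSpace ℝ V₁] [NormedAddCommGroup V₂] [NormedSpace ℝ V₂]

/-- The full contraction of a symbol with a multilinear map. -/
def contr {k : ℕ} (L : ContinuousMultilinearMap ℝ (fun _ : Fin k => Rm m) V₁) :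
    Symb m V₁ V₂ k →ₗ[ℝ] V₂ where
  toFun S := (k.factorial : ℝ)⁻¹ • ∑ d : Fin k → Fin m,
    (S (fun t => coordD m (d t))) (L (fun t => Pi.single (d t) 1))
  map_add' S S' := by simp [Finset.sum_add_distrib]
  map_smul' c S := by simp [← Finset.smul_sum, smul_comm c]

theorem contr_sub {k : ℕ} (L : ContinuousMultilinearMap ℝ (fun _ : Fin k => Rm m) V₁)
    (S S' : Symb m V₁ V₂ k) :
    contr m V₁ V₂ L (S - S') = contr m V₁ V₂ L S - contr m V₁ V₂ L S' :=
  (contr m V₁ V₂ L).map_sub S S'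

theorem QAff_eq_contr {k : ℕ} (T : Rm m → Symb m V₁ V₂ k) (f : Rm m → V₁) (x : Rm m) :
    QAff m V₁ V₂ T f x = contr m V₁ V₂ (iteratedFDeriv ℝ k f x) (T x) := rfl

theorem pureT_apply {k : ℕ} (v : Fin k → Rm m) (A : V₁ →L[ℝ] V₂) (ξ : Fin k → Dualm m) :
    pureT m V₁ V₂ v A ξ = (∏ t, ξ t (v t)) • A := by
  simp [pureT]

theorem contr_pureT {k : ℕ} (L : ContinuousMultilinearMap ℝ (fun _ : Fin k => Rm m) V₁)
    (v : Fin k → Rm m) (A : V₁ →L[ℝ] V₂) :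
    contr m V₁ V₂ L (pureT m V₁ V₂ v A) = (k.factorial : ℝ)⁻¹ • A (L v) := by
  have hv : v = fun t => ∑ j, v t j • (Pi.single j 1 : Rm m) :=
    funext fun t => pi_eq_sum_univ' (v t)
  conv_rhs => rw [hv, L.map_sum]
  simp only [L.map_smul_univ, map_sum, map_smul]
  simp [contr, pureT_apply, coordD]

theorem contr_symT {k : ℕ} {L : ContinuousMultilinearMap ℝ (fun _ : Fin k => Rm m) V₁}
    (hL : ∀ (v : Fin k → Rm m) (ν : Equiv.Perm (Fin k)), L (v ∘ ν) = L v)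
    (v : Fin k → Rm m) (A : V₁ →L[ℝ] V₂) :
    contr m V₁ V₂ L (symT m V₁ V₂ v A) = A (L v) := by
  have hk : (k.factorial : ℝ) ≠ 0 := by exact_mod_cast k.factorial_ne_zero
  simp [symT, contr_pureT, hL, Fintype.card_perm, ← Nat.cast_smul_eq_nsmul ℝ, smul_smul, hk]

variable (σ₁ : GLm m →ₗ[ℝ] (V₁ →L[ℝ] V₁)) (σ₂ : GLm m →ₗ[ℝ] (V₂ →L[ℝ] V₂))

theorem isLinearMap_sigmaS {k : ℕ} (B : GLm m) :
    IsLinearMap ℝ (sigmaS m V₁ V₂ σ₁ σ₂ B : Symb m V₁ V₂ k → Symb m V₁ V₂ k) where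
  map_add S S' := by
    ext ξ u
    simp [sigmaS, Finset.sum_add_distrib]
    abel
  map_smul c S := by
    ext ξ u
    simp [sigmaS, Finset.smul_sum, smul_add, smul_sub]

theorem sigmaS_pureT {k : ℕ} (B : GLm m) (v : Fin k → Rm m) (A : V₁ →L[ℝ] V₂) :
    sigmaS m V₁ V₂ σ₁ σ₂ B (pureT m V₁ V₂ v A)
      = (∑ t, pureT m V₁ V₂ (Function.update v t (B (v t))) A)
        + (pureT m V₁ V₂ v (σ₂ B ∘L A) - pureT m V₁ V₂ v (A ∘L σ₁ B)) := by
  ext ξ u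
  have hprod : ∀ t : Fin k, (∏ s, (if s = t then
      (ContinuousLinearMap.compL ℝ (Rm m) (Rm m) ℝ).flip B
        else ContinuousLinearMap.id ℝ (Dualm m)) (ξ s) (v s))
      = ∏ s, ξ s (Function.update v t (B (v t)) s) := fun t =>
    Finset.prod_congr rfl fun s _ => by
      rcases eq_or_ne s t with rfl | hst
      · simp
      · simp [hst]
  simp [sigmaS, pureT_apply, hprod]

theorem sigmaS_symT {k : ℕ} (B : GLm m) (v : Fin k → Rm m) (A : V₁ →L[ℝ] V₂) :
    sigmaS m V₁ V₂ σ₁ σ₂ B (symT m V₁ V₂ v A)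
      = (∑ t, symT m V₁ V₂ (Function.update v t (B (v t))) A)
        + (symT m V₁ V₂ v (σ₂ B ∘L A) - symT m V₁ V₂ v (A ∘L σ₁ B)) := by
  have hsum := map_sum ((isLinearMap_sigmaS m V₁ V₂ σ₁ σ₂ (k := k) B).mk' _)
    (fun ν : Equiv.Perm (Fin k) => pureT m V₁ V₂ (v ∘ ν) A) Finset.univ
  simp only [IsLinearMap.mk'_apply, sigmaS_pureT] at hsum
  simp only [symT]
  rw [hsum, Finset.sum_add_distrib]
  refine congrArg₂ (· + ·) ?_ (by ext; simp)
  conv_rhs => rw [Finset.sum_comm]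
  refine Finset.sum_congr rfl fun ν _ => ?_
  conv_rhs => rw [← Equiv.sum_comp ν]
  refine Finset.sum_congr rfl fun t _ => ?_
  rw [Function.update_comp_equiv]
  simp

theorem fderiv_QAff {k : ℕ} {T : Rm m → Symb m V₁ V₂ k} {f : Rm m → V₁} {x : Rm m}
    (hT : DifferentiableAt ℝ T x) (hf : DifferentiableAt ℝ (iteratedFDeriv ℝ k f) x) (u : Rm m) :
    fderiv ℝ (QAff m V₁ V₂ T f) x u
      = contr m V₁ V₂ (iteratedFDeriv ℝ k f x) (fderiv ℝ T x u)
        + contr m V₁ V₂ (fderiv ℝ (iteratedFDeriv ℝ k f) x u) (T x) := by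
  have h1 (d : Fin k → Fin m) : HasFDerivAt (fun y => T y (fun t => coordD m (d t))) _ x :=
    hT.hasFDerivAt.continuousMultilinear_apply_const _
  have h2 (d : Fin k → Fin m) :
      HasFDerivAt (fun y => iteratedFDeriv ℝ k f y (fun t => Pi.single (d t) 1)) _ x :=
    hf.hasFDerivAt.continuousMultilinear_apply_const _
  have hQ : HasFDerivAt (QAff m V₁ V₂ T f) _ x :=
    (HasFDerivAt.fun_sum fun d (_ : d ∈ Finset.univ) =>
      (h1 d).clm_apply (h2 d)).const_smul (k.factorial : ℝ)⁻¹
  rw [hQ.fderiv]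
  simp [contr, Finset.sum_add_distrib, add_comm]

end Contraction

/-- The derivative of the vector field `x ↦ h x • x`, as a linear function of the base point. -/
def quadDeriv (m : ℕ) (h : Dualm m) : Rm m →L[ℝ] GLm m :=
  (ContinuousLinearMap.lsmul ℝ ℝ : ℝ →L[ℝ] Rm m →L[ℝ] Rm m) ∘L h
    + ((ContinuousLinearMap.lsmul ℝ ℝ : ℝ →L[ℝ] Rm m →L[ℝ] Rm m) ∘L h).flip

theorem quadDeriv_apply (m : ℕ) (h : Dualm m) (y u : Rm m) :
    quadDeriv m h y u = h y • u + h u • y := by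
  simp [quadDeriv]

theorem quadDeriv_eq (m : ℕ) (h : Dualm m) (y : Rm m) :
    quadDeriv m h y = rkOne m y h + h y • ContinuousLinearMap.id ℝ (Rm m) := by
  ext1 u
  simp [quadDeriv_apply, rkOne, add_comm]

theorem hasFDerivAt_quad (m : ℕ) (h : Dualm m) (y : Rm m) :
    HasFDerivAt (fun x => h x • x) (quadDeriv m h y) y := by
  refine (h.hasFDerivAt.smul (hasFDerivAt_id y)).congr_fderiv ?_
  ext1 u
  simp [quadDeriv_apply]

/-- The defect of equivariance of the affine quantization, contracted pointwise with a symbol. -/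
theorem contr_gamma (m k : ℕ) (V₁ V₂ : Type) [NormedAddCommGroup V₁] [NormedSpace ℝ V₁]
    [NormedAddCommGroup V₂] [NormedSpace ℝ V₂]
    (σ₁ : GLm m →ₗ[ℝ] (V₁ →L[ℝ] V₁)) (σ₂ : GLm m →ₗ[ℝ] (V₂ →L[ℝ] V₂))
    (γ : Dualm m → (Symb m V₁ V₂ (k+1) →ₗ[ℝ] Symb m V₁ V₂ k))
    (hγ : gammaProp m V₁ V₂ σ₁ γ) (h : Dualm m)
    {f g : Rm m → V₁} (hf : ContDiff ℝ (⊤ : ℕ∞) f)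
    (hg : g = lieD m (fun B u => σ₁ B u) (fun x => h x • x) f)
    (x : Rm m) {S : Symb m V₁ V₂ (k+1)} (hS : S ∈ spanGen m V₁ V₂ (k+1)) :
    contr m V₁ V₂ (fderiv ℝ (iteratedFDeriv ℝ (k+1) f) x (h x • x)) S
        - σ₂ (quadDeriv m h x) (contr m V₁ V₂ (iteratedFDeriv ℝ (k+1) f x) S)
        - contr m V₁ V₂ (iteratedFDeriv ℝ (k+1) g x) S
        + contr m V₁ V₂ (iteratedFDeriv ℝ (k+1) f x)
          (sigmaS m V₁ V₂ σ₁ σ₂ (quadDeriv m h x) S)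
      = contr m V₁ V₂ (iteratedFDeriv ℝ k f x) (γ h S) := by
  have hσ := isLinearMap_sigmaS m V₁ V₂ σ₁ σ₂ (k := k + 1) (quadDeriv m h x)
  let B : Rm m →L[ℝ] V₁ →L[ℝ] V₁ :=
    LinearMap.toContinuousLinearMap (σ₁ ∘ₗ (quadDeriv m h : Rm m →ₗ[ℝ] GLm m))
  have hB : ∀ y, B y = σ₁ (quadDeriv m h y) := fun _ => rfl
  have hgB : g = fun y => fderiv ℝ f y (h y • y) - B y (f y) := by
    rw [hg]
    funext y
    simp only [lieD, (hasFDerivAt_quad m h y).fderiv, hB]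
  have hgc : ContDiff ℝ (⊤ : ℕ∞) g := hgB ▸ contDiff_firstOrder (hasFDerivAt_quad m h) B hf
  induction hS using Submodule.span_induction with
  | mem S hS =>
    obtain ⟨v, A, rfl⟩ := hS
    have hL : ∀ (n : ℕ) (w : Fin n → Rm m) (ν : Equiv.Perm (Fin n)),
        iteratedFDeriv ℝ n f x (w ∘ ν) = iteratedFDeriv ℝ n f x w := fun n w ν =>
      iteratedFDeriv_comp_perm hf w x ν
    have hL' : ∀ (w : Fin (k + 1) → Rm m) (ν : Equiv.Perm (Fin (k + 1))),
        fderiv ℝ (iteratedFDeriv ℝ (k+1) f) x (h x • x) (w ∘ ν)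
          = fderiv ℝ (iteratedFDeriv ℝ (k+1) f) x (h x • x) w := fun w ν => by
      simp only [← fderiv_iteratedFDeriv_apply hf, iteratedFDeriv_comp_perm hf]
    have hLg : ∀ (w : Fin (k + 1) → Rm m) (ν : Equiv.Perm (Fin (k + 1))),
        iteratedFDeriv ℝ (k+1) g x (w ∘ ν) = iteratedFDeriv ℝ (k+1) g x w := fun w ν =>
      iteratedFDeriv_comp_perm hgc w x ν
    have hsub : ∀ i j : Fin (k + 1), h (v j) • v i + h (v i) • v j = quadDeriv m h (v j) (v i) :=
      fun i j => (quadDeriv_apply m h _ _).symm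
    rw [hγ, sigmaS_symT]
    simp only [map_add, contr_sub, map_sum, apply_ite, map_zero, contr_symT m V₁ V₂ hL',
      contr_symT m V₁ V₂ hLg, contr_symT m V₁ V₂ (hL _), hsub, ← quadDeriv_eq]
    rw [hgB, iteratedFDeriv_firstOrder (hasFDerivAt_quad m h) B hf]
    simp only [map_add, map_sub, map_sum, apply_ite, map_zero, hB, iteratedFDeriv_update hf,
      fderiv_iteratedFDeriv_apply hf, ContinuousLinearMap.comp_apply]
    abel
  | zero => simp [hσ.map_zero]
  | add S S' _ _ ih ih' =>
    rw [hσ.map_add]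
    simp only [map_add, ← ih, ← ih']
    abel
  | smul c S _ ih =>
    rw [hσ.map_smul]
    simp only [map_smul, ← ih, smul_add, smul_sub]

/-- for `h ∈ 𝔤₁`,
`L_{X^h}(Q_Aff(T)f) - Q_Aff(T)(L_{X^h}f) - Q_Aff(L_{X^h}T)(f) = Q_Aff(γ(h)∘T)(f)`,
where `X^h(x) = h(x)·x`. -/
theorem statement4 (m k : ℕ) (hm : 2 ≤ m)
    (V₁ V₂ : Type) [NormedAddCommGroup V₁] [NormedSpace ℝ V₁] [FiniteDimensional ℝ V₁]
    [NormedAddCommGroup V₂] [NormedSpace ℝ V₂] [FiniteDimensional ℝ V₂]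
    (σ₁ : GLm m →ₗ[ℝ] (V₁ →L[ℝ] V₁)) (hσ₁ : IsLieRep m σ₁)
    (σ₂ : GLm m →ₗ[ℝ] (V₂ →L[ℝ] V₂)) (hσ₂ : IsLieRep m σ₂)
    (γ : Dualm m → (Symb m V₁ V₂ (k+1) →ₗ[ℝ] Symb m V₁ V₂ k))
    (hγ : gammaProp m V₁ V₂ σ₁ γ)
    (h : Dualm m)
    (T : Rm m → Symb m V₁ V₂ (k+1)) (hT : ContDiff ℝ (⊤ : ℕ∞) T)
    (hTval : ∀ x, T x ∈ spanGen m V₁ V₂ (k+1))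
    (f : Rm m → V₁) (hf : ContDiff ℝ (⊤ : ℕ∞) f) :
    lieD m (fun B u => σ₂ B u) (fun x => h x • x) (QAff m V₁ V₂ T f)
        - QAff m V₁ V₂ T (lieD m (fun B u => σ₁ B u) (fun x => h x • x) f)
        - QAff m V₁ V₂ (lieD m (fun B S => sigmaS m V₁ V₂ σ₁ σ₂ B S) (fun x => h x • x) T) f
      = QAff m V₁ V₂ (fun x => γ h (T x)) f := by
  funext x
  have hTd := hT.differentiable (by simp) x
  have hfd := (contDiff_iteratedFDeriv hf (k + 1)).differentiable (by simp) x
  rw [QAff_eq_contr, ← contr_gamma m k V₁ V₂ σ₁ σ₂ γ hγ h hf rfl x (hTval x)]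
  simp only [Pi.sub_apply]
  rw [lieD, fderiv_QAff m V₁ V₂ hTd hfd, (hasFDerivAt_quad m h x).fderiv]
  simp only [QAff_eq_contr]
  rw [lieD.eq_def m (fun B S => sigmaS m V₁ V₂ σ₁ σ₂ B S), (hasFDerivAt_quad m h x).fderiv,
    map_sub]
  abel

end ProjQuant
end
end
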